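/- arXiv:1105.3368 — 8 statements merged into one kernel-verified Lean document; each statement's English description precedes it below -/
import Mathlib

section
/- Let S be a sandpile (a finite connected multigraph with sink s). For every configuration c there exists a unique stable configuration σ(c) with c ⊢ σ(c); every maximal sequence of topplings starting from c is finite and terminates in σ(c), regardless of the order in which unstable vertices are chosen to topple. Moreover, for each ordinary vertex v, the number of times v topples is the same in every toppling sequence from c to σ(c). -/
/-- A sandpile: a finite connected multigraph with a distinguished sink.
`m u v` is the number of parallel edges joining `u` and `v`. -/
structure Sandpile where
  V : Type
  fintypeV : Fintype V
  decEqV : DecidableEq V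
  m : V → V → ℕ
  m_symm : ∀ u v, m u v = m v u
  m_loopless : ∀ v, m v v = 0
  sink : V
  connected : ∀ u v : V, Relation.ReflTransGen (fun a b => 0 < m a b) u v

attribute [instance] Sandpile.fintypeV Sandpile.decEqV

namespace Sandpile

/-- Degree of a vertex: total multiplicity of incident edges. -/
def deg (S : Sandpile) (v : S.V) : ℕ := ∑ u, S.m v u

/-- Ordinary (non-sink) vertices. -/
abbrev Ord (S : Sandpile) := {v : S.V // v ≠ S.sink}

/-- A configuration assigns a number of particles to each ordinary vertex. -/
abbrev Config (S : Sandpile) := S.Ord → ℕ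

/-- Toppling an ordinary vertex `v`: `v` loses `deg v` particles and each ordinary
vertex `u` receives `m v u` particles (particles sent to the sink disappear). -/
def topple (S : Sandpile) (c : S.Config) (v : S.Ord) : S.Config :=
  fun u => if u = v then c v - S.deg v.1 else c u + S.m v.1 u.1

/-- A configuration is stable if no ordinary vertex is unstable. -/
def Stable (S : Sandpile) (c : S.Config) : Prop := ∀ v : S.Ord, c v < S.deg v.1

/-- Validity of a toppling sequence (given as the list of vertices toppled, in
order): every toppled vertex must be unstable at its turn. -/
inductive ValidSeq (S : Sandpile) : S.Config → List S.Ord → Prop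
  | nil (c : S.Config) : ValidSeq S c []
  | cons (c : S.Config) (v : S.Ord) (l : List S.Ord) (h : S.deg v.1 ≤ c v)
      (h' : ValidSeq S (S.topple c v) l) : ValidSeq S c (v :: l)

/-- The result of performing a sequence of topplings. -/
def toppleSeq (S : Sandpile) (c : S.Config) : List S.Ord → S.Config
  | [] => c
  | v :: l => toppleSeq S (S.topple c v) l

/-- `c₁ ⊢ c₂` : some valid toppling sequence takes `c₁` to `c₂`. -/
def Topples (S : Sandpile) (c₁ c₂ : S.Config) : Prop :=
  ∃ l : List S.Ord, S.ValidSeq c₁ l ∧ S.toppleSeq c₁ l = c₂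

/-- `c₂` is reachable from `c₁`: one may add particles to `c₁` and then topple to `c₂`. -/
def Reaches (S : Sandpile) (c₁ c₂ : S.Config) : Prop :=
  ∃ c₃ : S.Config, (∀ v, c₁ v ≤ c₃ v) ∧ S.Topples c₃ c₂

/-- A configuration is recurrent if it is reachable from every configuration. -/
def Recurrent (S : Sandpile) (c : S.Config) : Prop := ∀ c' : S.Config, S.Reaches c' c

/-- Adding a single particle at the ordinary vertex `v`. -/
def addAt (S : Sandpile) (c : S.Config) (v : S.Ord) : S.Config :=
  Function.update c v (c v + 1)

/-- The multigraph induced on the ordinary vertices is connected. -/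
def OrdinaryConnected (S : Sandpile) : Prop :=
  ∀ u v : S.Ord, Relation.ReflTransGen (fun a b : S.Ord => 0 < S.m a.1 b.1) u v

/-- `π` is the discrete harmonic potential with unit potential at `w` and the sink
grounded: `π(s) = 0`, `π(w) = 1`, `0 ≤ π ≤ 1`, and `π` is harmonic away from `s, w`.
Probabilistically, `π v` is the probability that simple random walk started at `v`
hits `w` before the sink. -/
def IsPotential (S : Sandpile) (w : S.Ord) (π : S.V → ℝ) : Prop :=
  π S.sink = 0 ∧ π w.1 = 1 ∧ (∀ u, 0 ≤ π u ∧ π u ≤ 1) ∧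
    ∀ u : S.V, u ≠ S.sink → u ≠ w.1 →
      (S.deg u : ℝ) * π u = ∑ u', (S.m u u' : ℝ) * π u'

end Sandpile

namespace Sandpile

theorem topple_add (S : Sandpile) {c : S.Config} {v : S.Ord} (h : S.deg v.1 ≤ c v) (u : S.Ord) :
    S.topple c v u + (if u = v then S.deg v.1 else 0) = c u + S.m v.1 u.1 := by
  unfold topple
  split_ifs with huv
  · subst huv
    rw [S.m_loopless]
    omega
  · rfl

/-- The number of particles at `u` after a valid toppling sequence depends only on how often each
vertex topples. -/
theorem ValidSeq.toppleSeq_add {S : Sandpile} {c : S.Config} {l : List S.Ord}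
    (hl : S.ValidSeq c l) (u : S.Ord) :
    S.toppleSeq c l u + l.count u * S.deg u.1 = c u + ∑ v : S.Ord, l.count v * S.m v.1 u.1 := by
  induction hl with
  | nil c => simp [toppleSeq]
  | cons c v l h _ ih =>
    have ht := S.topple_add h u
    have hsum : ∑ w : S.Ord, (v :: l).count w * S.m w.1 u.1
        = ∑ w : S.Ord, l.count w * S.m w.1 u.1 + S.m v.1 u.1 := by
      simp [List.count_cons, add_mul, Finset.sum_add_distrib, ← Subtype.ext_iff]
    rw [hsum, toppleSeq, List.count_cons, add_mul]
    by_cases huv : u = v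
    · subst huv
      simp at ht ⊢
      omega
    · have hvu : ¬ v.1 = u.1 := fun h => huv (Subtype.ext h.symm)
      simp [huv] at ht
      simp [hvu]
      omega

theorem validSeq_append_singleton_iff (S : Sandpile) (c : S.Config) (l : List S.Ord) (v : S.Ord) :
    S.ValidSeq c (l ++ [v]) ↔ S.ValidSeq c l ∧ S.deg v.1 ≤ S.toppleSeq c l v := by
  induction l generalizing c with
  | nil =>
    constructor
    · rintro (_ | ⟨_, _, _, h, _⟩)
      exact ⟨.nil c, h⟩
    · rintro ⟨-, h⟩
      exact .cons c v [] h (.nil _)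
  | cons w l ih =>
    constructor
    · rintro (_ | ⟨_, _, _, h, h'⟩)
      obtain ⟨h₁, h₂⟩ := (ih _).1 h'
      exact ⟨.cons c w l h h₁, h₂⟩
    · rintro ⟨_ | ⟨_, _, _, h, h'⟩, h₂⟩
      exact .cons c w _ h ((ih _).2 ⟨h', h₂⟩)

/-- Least action principle: no valid toppling sequence topples a vertex more often than a
stabilizing one. -/
theorem ValidSeq.count_le_of_stable {S : Sandpile} {c : S.Config} {l l' : List S.Ord}
    (hl : S.ValidSeq c l) (hl' : S.ValidSeq c l') (hs : S.Stable (S.toppleSeq c l')) (v : S.Ord) :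
    l.count v ≤ l'.count v := by
  induction l using List.reverseRecOn generalizing v with
  | nil => simp
  | append_singleton l w ih =>
    obtain ⟨hv, hw⟩ := (S.validSeq_append_singleton_iff c l w).1 hl
    by_cases hvw : v = w
    · subst hvw
      by_contra hlt
      have hle := ih hv v
      have heq : l.count v = l'.count v := by
        simp at hlt
        omega
      have h₁ := hv.toppleSeq_add v
      have h₂ := hl'.toppleSeq_add v
      have h₃ : ∑ u : S.Ord, l.count u * S.m u.1 v.1 ≤ ∑ u : S.Ord, l'.count u * S.m u.1 v.1 :=
        Finset.sum_le_sum fun u _ => Nat.mul_le_mul_right _ (ih hv u)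
      have h₄ := hs v
      rw [heq] at h₁
      omega
    · have hwv : ¬ w = v := fun h => hvw h.symm
      simpa [List.count_append, hwv] using ih hv v

/-- There is a rank function for which every ordinary vertex has a neighbour of lower rank. -/
theorem exists_rank (S : Sandpile) :
    ∃ d : S.V → ℕ, d S.sink = 0 ∧ ∀ v, v ≠ S.sink → ∃ u, 0 < S.m v u ∧ d u < d v := by
  let G : SimpleGraph S.V :=
    { Adj := fun a b => 0 < S.m a b
      symm := ⟨fun a b h => by rwa [S.m_symm b a]⟩
      loopless := ⟨fun a h => by simp [S.m_loopless] at h⟩ }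
  have hG : ∀ u v, G.Reachable u v := fun u v => by
    induction S.connected u v with
    | refl => exact .refl u
    | tail _ h ih => exact ih.trans (SimpleGraph.Adj.reachable (G := G) h)
  refine ⟨fun v => G.dist v S.sink, SimpleGraph.dist_self, fun v hv => ?_⟩
  obtain ⟨p, hp⟩ := (hG v S.sink).exists_walk_length_eq_dist
  cases p with
  | nil => exact absurd rfl hv
  | cons h q =>
    have hq := SimpleGraph.dist_le q
    rw [SimpleGraph.Walk.length_cons] at hp
    exact ⟨_, h, Nat.lt_of_le_of_lt hq (Nat.lt_of_succ_le hp.le)⟩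

/-- There is a function vanishing at the sink and strictly superharmonic at every ordinary
vertex. -/
theorem exists_superharmonic (S : Sandpile) :
    ∃ h : S.V → ℕ, h S.sink = 0 ∧
      ∀ v, v ≠ S.sink → ∑ u, S.m v u * h u < S.deg v * h v := by
  obtain ⟨d, hd₀, hd⟩ := S.exists_rank
  set D := Finset.univ.sup d
  set B := ∑ v, S.deg v + 1
  have hdD : ∀ v, d v ≤ D := fun v => Finset.le_sup (Finset.mem_univ v)
  have hB : ∀ v, S.deg v < B := fun v =>
    Nat.lt_succ_of_le (Finset.single_le_sum (fun _ _ => Nat.zero_le _) (Finset.mem_univ v))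
  have hB₀ : 0 < B := Nat.succ_pos _
  have hgD : ∀ v, B ^ (D - d v) ≤ B ^ D := fun v => Nat.pow_le_pow_right hB₀ (Nat.sub_le _ _)
  refine ⟨fun v => B ^ D - B ^ (D - d v), by simp [hd₀], fun v hv => ?_⟩
  obtain ⟨u₀, hu₀, hlt⟩ := hd v hv
  have hsum : ∑ u, S.m v u * (B ^ D - B ^ (D - d u)) + ∑ u, S.m v u * B ^ (D - d u)
      = S.deg v * (B ^ D - B ^ (D - d v)) + S.deg v * B ^ (D - d v) := by
    rw [← Finset.sum_add_distrib, ← mul_add, Nat.sub_add_cancel (hgD v), deg, Finset.sum_mul]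
    exact Finset.sum_congr rfl fun u _ => by rw [← mul_add, Nat.sub_add_cancel (hgD u)]
  have hbig : S.deg v * B ^ (D - d v) < ∑ u, S.m v u * B ^ (D - d u) :=
    calc S.deg v * B ^ (D - d v) < B * B ^ (D - d v) :=
          Nat.mul_lt_mul_of_pos_right (hB v) (pow_pos hB₀ _)
      _ = B ^ (D - d v + 1) := (pow_succ' _ _).symm
      _ ≤ B ^ (D - d u₀) := Nat.pow_le_pow_right hB₀ (by have := hdD v; omega)
      _ ≤ S.m v u₀ * B ^ (D - d u₀) := Nat.le_mul_of_pos_left _ hu₀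
      _ ≤ _ := Finset.single_le_sum (f := fun u => S.m v u * B ^ (D - d u))
          (fun _ _ => Nat.zero_le _) (Finset.mem_univ u₀)
  show ∑ u, S.m v u * (B ^ D - B ^ (D - d u)) < S.deg v * (B ^ D - B ^ (D - d v))
  omega

theorem sum_ord_eq_of_sink_eq_zero (S : Sandpile) {f : S.V → ℕ} (hf : f S.sink = 0) :
    ∑ u : S.Ord, f u.1 = ∑ u, f u := by
  exact (Finset.sum_subtype (Finset.univ.erase S.sink) (by simp) f).symm.trans
    (Finset.sum_erase _ hf)

theorem sum_topple_mul_lt (S : Sandpile) {h : S.V → ℕ} (h₀ : h S.sink = 0)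
    (hh : ∀ v, v ≠ S.sink → ∑ u, S.m v u * h u < S.deg v * h v)
    {c : S.Config} {v : S.Ord} (hv : S.deg v.1 ≤ c v) :
    ∑ u : S.Ord, S.topple c v u * h u.1 < ∑ u : S.Ord, c u * h u.1 := by
  have hsum : ∑ u : S.Ord, (S.topple c v u + (if u = v then S.deg v.1 else 0)) * h u.1
      = ∑ u : S.Ord, (c u + S.m v.1 u.1) * h u.1 :=
    Finset.sum_congr rfl fun u _ => by rw [S.topple_add hv]
  simp only [add_mul, Finset.sum_add_distrib, ite_mul, zero_mul, Finset.sum_ite_eq',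
    Finset.mem_univ, if_true] at hsum
  rw [S.sum_ord_eq_of_sink_eq_zero (f := fun u => S.m v.1 u * h u) (by simp [h₀])] at hsum
  have := hh v.1 v.2
  omega

theorem exists_stabilizing (S : Sandpile) (c : S.Config) :
    ∃ l, S.ValidSeq c l ∧ S.Stable (S.toppleSeq c l) := by
  obtain ⟨h, h₀, hh⟩ := S.exists_superharmonic
  induction hn : ∑ u : S.Ord, c u * h u.1 using Nat.strong_induction_on generalizing c with
  | _ n ih =>
    by_cases hs : S.Stable c
    · exact ⟨[], .nil c, hs⟩
    · simp only [Stable, not_forall, not_lt] at hs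
      obtain ⟨v, hv⟩ := hs
      obtain ⟨l, hl, hls⟩ := ih _ (hn ▸ S.sum_topple_mul_lt h₀ hh hv) (S.topple c v) rfl
      exact ⟨v :: l, .cons c v l hv hl, hls⟩

end Sandpile

/-- For every configuration `c` of a sandpile `S` there is a unique
stable configuration `σ(c)` with `c ⊢ σ(c)`; every maximal toppling sequence from `c`
is finite (lengths of valid toppling sequences from `c` are uniformly bounded) and
terminates in `σ(c)` regardless of the order of topplings; moreover every ordinary
vertex topples the same number of times in every toppling sequence from `c` to `σ(c)`. -/
theorem abelian_sandpile_stabilization (S : Sandpile) (c : S.Config) :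
    ∃ σc : S.Config, S.Stable σc ∧ S.Topples c σc ∧
      (∃ N : ℕ, ∀ l : List S.Ord, S.ValidSeq c l → l.length ≤ N) ∧
      (∀ l : List S.Ord, S.ValidSeq c l → S.Stable (S.toppleSeq c l) →
        S.toppleSeq c l = σc) ∧
      (∀ l₁ l₂ : List S.Ord, S.ValidSeq c l₁ → S.ValidSeq c l₂ →
        S.Stable (S.toppleSeq c l₁) → S.Stable (S.toppleSeq c l₂) →
        ∀ v : S.Ord, l₁.count v = l₂.count v) := by
  obtain ⟨l₀, hl₀, hs₀⟩ := S.exists_stabilizing c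
  have hcount : ∀ l₁ l₂ : List S.Ord, S.ValidSeq c l₁ → S.ValidSeq c l₂ →
      S.Stable (S.toppleSeq c l₁) → S.Stable (S.toppleSeq c l₂) →
      ∀ v : S.Ord, l₁.count v = l₂.count v := fun l₁ l₂ h₁ h₂ hs₁ hs₂ v =>
    le_antisymm (h₁.count_le_of_stable h₂ hs₂ v) (h₂.count_le_of_stable h₁ hs₁ v)
  refine ⟨S.toppleSeq c l₀, hs₀, ⟨l₀, hl₀, rfl⟩, ⟨l₀.length, fun l hl => ?_⟩,
    fun l hl hs => funext fun u => ?_, hcount⟩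
  · exact (List.subperm_ext_iff.2 fun v _ => hl.count_le_of_stable hl₀ hs₀ v).length_le
  · have h₁ := hl.toppleSeq_add u
    have h₂ := hl₀.toppleSeq_add u
    simp only [hcount l l₀ hl hl₀ hs hs₀] at h₁
    omega
end

section
/- Let S be a sandpile and c a configuration. If there exist a configuration c' and a toppling sequence from c' to c in which every ordinary vertex topples at least once, then c is recurrent, i.e., c is reachable from every configuration of S. -/
namespace Sandpile

variable (S : Sandpile)

theorem deg_eq (v : S.V) : S.deg v = S.m v S.sink + ∑ u : S.Ord, S.m v u.1 := by
  have h := Fintype.sum_eq_add_sum_subtype_ne (fun u => S.m v u) S.sink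
  simpa [deg] using h

theorem toppleSeq_apply_of_notMem (c : S.Config) (l : List S.Ord) (v : S.Ord) (hv : v ∉ l) :
    S.toppleSeq c l v = c v + (l.map fun u => S.m u.1 v.1).sum := by
  induction l generalizing c with
  | nil => simp [toppleSeq]
  | cons a l ih =>
    simp only [List.mem_cons, not_or] at hv
    simp [toppleSeq, ih _ hv.2, topple, hv.1, add_assoc]

theorem sum_toFinset_le_sum_map {α : Type*} [DecidableEq α] (l : List α) (f : α → ℕ) :
    ∑ u ∈ l.toFinset, f u ≤ (l.map f).sum := by
  rw [Finset.sum_list_map_count]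
  exact Finset.sum_le_sum fun u hu =>
    Nat.le_mul_of_pos_left _ (List.count_pos_iff.2 (List.mem_toFinset.1 hu))

/-- No nonempty set of ordinary vertices is a forbidden subconfiguration of `c`. -/
def NoForbidden (c : S.Config) : Prop :=
  ∀ B : Finset S.Ord, B.Nonempty → ∃ v ∈ B, ∑ u ∈ B, S.m u.1 v.1 ≤ c v

theorem exists_sum_le_toppleSeq (c : S.Config) (l : List S.Ord) (B : Finset S.Ord)
    (hB : B.Nonempty) (hl : ∀ v ∈ B, v ∈ l) :
    ∃ v ∈ B, ∑ u ∈ B, S.m u.1 v.1 ≤ S.toppleSeq c l v := by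
  induction l generalizing c with
  | nil => obtain ⟨v, hv⟩ := hB; simpa using hl v hv
  | cons a l ih =>
    by_cases h : ∀ v ∈ B, v ∈ l
    · exact ih _ h
    push Not at h
    obtain ⟨v, hvB, hvl⟩ := h
    obtain rfl : v = a := by simpa [hvl] using hl v hvB
    refine ⟨v, hvB, ?_⟩
    rw [toppleSeq, toppleSeq_apply_of_notMem S _ _ _ hvl, ← Finset.sum_erase B (S.m_loopless v.1)]
    have hsub : B.erase v ⊆ l.toFinset := fun u hu => by
      rw [Finset.mem_erase] at hu
      simpa [hu.1] using hl u hu.2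
    exact (Finset.sum_le_sum_of_subset hsub).trans
      ((sum_toFinset_le_sum_map l _).trans (Nat.le_add_left _ _))

/-- The reduced Laplacian of the sandpile. -/
def laplacian : (S.Ord → ℤ) →ₗ[ℤ] (S.Ord → ℤ) where
  toFun h v := S.deg v.1 * h v - ∑ u : S.Ord, S.m u.1 v.1 * h u
  map_add' h k := by
    ext v
    simp only [Pi.add_apply, mul_add, Finset.sum_add_distrib]
    ring
  map_smul' r h := by
    ext v
    simp only [Pi.smul_apply, smul_eq_mul, RingHom.id_apply, mul_sub, Finset.mul_sum]
    simp only [mul_left_comm]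

theorem laplacian_apply (h : S.Ord → ℤ) (v : S.Ord) :
    S.laplacian h v = S.deg v.1 * h v - ∑ u : S.Ord, S.m u.1 v.1 * h u := rfl

theorem laplacian_single (w v : S.Ord) :
    S.laplacian (Pi.single w 1) v = if v = w then (S.deg w.1 : ℤ) else -S.m w.1 v.1 := by
  rw [laplacian_apply]
  by_cases h : v = w
  · subst h
    simp [Pi.single_apply, S.m_loopless]
  · simp [Pi.single_apply, h]

theorem laplacian_one (v : S.Ord) : S.laplacian 1 v = S.m v.1 S.sink := by
  simp [laplacian_apply, deg_eq, S.m_symm _ v.1]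

theorem topple_eq_sub_laplacian (c : S.Config) (v : S.Ord) (hv : S.deg v.1 ≤ c v) (u : S.Ord) :
    (S.topple c v u : ℤ) = c u - S.laplacian (Pi.single v 1) u := by
  rw [laplacian_single, topple]
  split_ifs with h
  · subst h
    push_cast [hv]
    ring
  · push_cast
    ring

variable {S}

theorem NoForbidden.exists_unstable {c : S.Config} (hc : S.NoForbidden c) (g : S.Config)
    (h : S.Ord → ℤ) (hpos : ∃ v, 0 < h v)
    (hg : ∀ v, (g v : ℤ) = c v + S.laplacian h v) :
    ∃ v, 0 < h v ∧ S.deg v.1 ≤ g v := by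
  obtain ⟨x, hx⟩ := hpos
  obtain ⟨w, -, hw⟩ := Finset.exists_max_image Finset.univ h ⟨x, Finset.mem_univ x⟩
  have hw' : ∀ u, h u ≤ h w := fun u => hw u (Finset.mem_univ u)
  have hwpos : 0 < h w := hx.trans_le (hw' x)
  obtain ⟨v, hvB, hv⟩ := hc (Finset.univ.filter fun u => h u = h w) ⟨w, by simp⟩
  have hvw : h v = h w := by simpa using hvB
  refine ⟨v, hvw ▸ hwpos, ?_⟩
  have hterm : ∑ u : S.Ord, (S.m u.1 v.1 : ℤ) * (1 - (h w - h u)) ≤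
      ∑ u ∈ Finset.univ.filter (fun u => h u = h w), (S.m u.1 v.1 : ℤ) := by
    rw [Finset.sum_filter]
    refine Finset.sum_le_sum fun u _ => ?_
    have hm : (0 : ℤ) ≤ S.m u.1 v.1 := Int.natCast_nonneg _
    split_ifs with hu
    · simp [hu]
    · have : h u < h w := lt_of_le_of_ne (hw' u) hu
      exact mul_nonpos_of_nonneg_of_nonpos hm (by omega)
  have hv' : ∑ u ∈ Finset.univ.filter (fun u => h u = h w), (S.m u.1 v.1 : ℤ) ≤ c v := by
    exact_mod_cast hv
  have hdeg : (S.deg v.1 : ℤ) = S.m v.1 S.sink + ∑ u : S.Ord, (S.m u.1 v.1 : ℤ) := by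
    rw [deg_eq]
    push_cast
    simp [S.m_symm v.1]
  have hexp : ∑ u : S.Ord, (S.m u.1 v.1 : ℤ) * (1 - (h w - h u)) =
      (1 - h w) * ∑ u : S.Ord, (S.m u.1 v.1 : ℤ) + ∑ u : S.Ord, (S.m u.1 v.1 : ℤ) * h u := by
    rw [Finset.mul_sum, ← Finset.sum_add_distrib]
    exact Finset.sum_congr rfl fun u _ => by ring
  have hgv := hg v
  rw [laplacian_apply, hvw] at hgv
  have hs : (0 : ℤ) ≤ S.m v.1 S.sink * (h w - 1) :=
    mul_nonneg (Int.natCast_nonneg _) (by omega)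
  zify
  rw [hdeg] at hgv ⊢
  nlinarith

theorem NoForbidden.topples {c : S.Config} (hc : S.NoForbidden c) (g : S.Config)
    (h : S.Ord → ℤ) (h0 : ∀ v, 0 ≤ h v) (hg : ∀ v, (g v : ℤ) = c v + S.laplacian h v) :
    S.Topples g c := by
  obtain ⟨n, hn⟩ := Int.eq_ofNat_of_zero_le (Finset.sum_nonneg fun v (_ : v ∈ Finset.univ) => h0 v)
  induction n generalizing g h with
  | zero =>
    have hz : h = 0 := by
      funext v
      exact (Finset.sum_eq_zero_iff_of_nonneg fun v _ => h0 v).1 (by simpa using hn) v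
        (Finset.mem_univ v)
    refine ⟨[], .nil g, ?_⟩
    funext v
    simpa [hz, toppleSeq] using hg v
  | succ n ih =>
    have hpos : ∃ v, 0 < h v := by
      by_contra! hle
      have := Finset.sum_nonpos fun v (_ : v ∈ Finset.univ) => hle v
      push_cast at hn
      omega
    obtain ⟨v, hv, hdeg⟩ := hc.exists_unstable g h hpos hg
    obtain ⟨l, hl, hlc⟩ := ih (S.topple g v) (h - Pi.single v 1)
      (fun u => by
        have := h0 u
        rcases eq_or_ne u v with rfl | huv
        · simpa using Int.add_one_le_of_lt hv
        · simpa [huv] using this)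
      (fun u => by
        rw [topple_eq_sub_laplacian S g v hdeg, hg u, map_sub, Pi.sub_apply]
        ring)
      (by
        simp only [Pi.sub_apply, Finset.sum_sub_distrib, hn, Finset.sum_pi_single',
          Finset.mem_univ, if_true]
        push_cast
        ring)
    exact ⟨v :: l, .cons g v l hdeg hl, hlc⟩

variable (S)

theorem exists_laplacian_pos (v : S.Ord) :
    ∃ h : S.Ord → ℤ, 0 ≤ h ∧ 0 ≤ S.laplacian h ∧ 0 < S.laplacian h v := by
  obtain ⟨x, hx⟩ := v
  induction S.connected S.sink x with
  | refl => exact absurd rfl hx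
  | @tail b x _ hbx ih =>
    by_cases hb : b = S.sink
    · subst hb
      refine ⟨1, zero_le_one, fun u => ?_, ?_⟩
      · simp [laplacian_one]
      · simpa [laplacian_one, S.m_symm x] using hbx
    obtain ⟨h, h0, hL, hLb⟩ := ih hb
    have hsum : 0 ≤ ∑ u : S.Ord, (S.m u.1 b : ℤ) * h u :=
      Finset.sum_nonneg fun u _ => mul_nonneg (Int.natCast_nonneg _) (h0 u)
    have hprod : 0 < (S.deg b : ℤ) * h ⟨b, hb⟩ := by
      rw [laplacian_apply] at hLb
      linarith
    have hL' : ∀ u, S.laplacian ((S.deg b : ℤ) • h - Pi.single ⟨b, hb⟩ 1) u =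
        S.deg b * S.laplacian h u - if u = ⟨b, hb⟩ then (S.deg b : ℤ) else -S.m b u.1 := by
      intro u
      rw [map_sub, map_smul, Pi.sub_apply, laplacian_single, Pi.smul_apply, smul_eq_mul]
    have hd : (0 : ℤ) ≤ S.deg b := Int.natCast_nonneg _
    refine ⟨(S.deg b : ℤ) • h - Pi.single ⟨b, hb⟩ 1, fun u => ?_, fun u => ?_, ?_⟩
    · have := mul_nonneg hd (h0 u)
      rcases eq_or_ne u ⟨b, hb⟩ with rfl | hu
      · simp only [Pi.zero_apply, Pi.sub_apply, Pi.smul_apply, smul_eq_mul, Pi.single_eq_same]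
        omega
      · simpa [hu] using this
    · rw [hL', Pi.zero_apply]
      split_ifs with hu
      · subst hu
        nlinarith
      · have := mul_nonneg hd (hL u)
        have hm : (0 : ℤ) ≤ S.m b u.1 := Int.natCast_nonneg _
        linarith
    · have hxb : (⟨x, hx⟩ : S.Ord) ≠ ⟨b, hb⟩ := by
        rintro ⟨⟩
        simp [S.m_loopless] at hbx
      rw [hL', if_neg hxb]
      have := mul_nonneg hd (hL ⟨x, hx⟩)
      have hm : (0 : ℤ) < S.m b x := by exact_mod_cast hbx
      dsimp only
      linarith

theorem exists_le_laplacian (d : S.Config) :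
    ∃ h : S.Ord → ℤ, 0 ≤ h ∧ ∀ v, (d v : ℤ) ≤ S.laplacian h v := by
  choose k hk hL hpos using S.exists_laplacian_pos
  refine ⟨∑ w, (d w : ℤ) • k w, Finset.sum_nonneg fun w _ =>
    smul_nonneg (Int.natCast_nonneg _) (hk w), fun v => ?_⟩
  simp only [map_sum, map_smul, Finset.sum_apply, Pi.smul_apply, smul_eq_mul]
  calc (d v : ℤ) ≤ d v * S.laplacian (k v) v :=
        le_mul_of_one_le_right (Int.natCast_nonneg _) (hpos v)
    _ ≤ _ := Finset.single_le_sum (f := fun w => (d w : ℤ) * S.laplacian (k w) v)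
        (fun w _ => mul_nonneg (Int.natCast_nonneg _) (hL w v)) (Finset.mem_univ v)

variable {S}

theorem NoForbidden.recurrent {c : S.Config} (hc : S.NoForbidden c) : S.Recurrent c := by
  intro d
  obtain ⟨h, h0, hd⟩ := S.exists_le_laplacian d
  have hle : ∀ v, (d v : ℤ) ≤ c v + S.laplacian h v := fun v =>
    (hd v).trans (le_add_of_nonneg_left (Int.natCast_nonneg _))
  have hcast : ∀ v, (((c v + S.laplacian h v).toNat : ℕ) : ℤ) = c v + S.laplacian h v := fun v =>
    Int.toNat_of_nonneg ((Int.natCast_nonneg _).trans (hle v))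
  exact ⟨fun v => (c v + S.laplacian h v).toNat, fun v => Int.ofNat_le.1 ((hle v).trans (hcast v).ge),
    hc.topples _ h h0 hcast⟩

end Sandpile

/-- If some configuration `c'` admits a valid toppling sequence
leading to `c` in which every ordinary vertex topples at least once, then `c` is
recurrent, i.e. reachable from every configuration. -/
theorem recurrent_of_all_toppled (S : Sandpile) (c c' : S.Config) (l : List S.Ord)
    (hvalid : S.ValidSeq c' l) (hresult : S.toppleSeq c' l = c)
    (hall : ∀ v : S.Ord, v ∈ l) :
    S.Recurrent c := by
  subst hresult
  exact Sandpile.NoForbidden.recurrent fun B hB =>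
    S.exists_sum_le_toppleSeq c' l B hB fun v _ => hall v
end

section
/- (Triangle inequality for potentials) Let G be a finite connected multigraph with sink s, and let i, j, k be ordinary vertices. Then π_i(j) · π_j(k) ≤ π_i(k). -/
/-- Maximum principle: a function that is nonpositive at the sink and harmonic wherever it is
positive is nonpositive everywhere. -/
theorem Sandpile.nonpos_of_harmonic (S : Sandpile) (h : S.V → ℝ) (h_sink : h S.sink ≤ 0)
    (harm : ∀ u, 0 < h u → (S.deg u : ℝ) * h u = ∑ v, (S.m u v : ℝ) * h v) (x : S.V) :
    h x ≤ 0 := by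
  obtain ⟨w, -, hw⟩ := Finset.exists_max_image Finset.univ h ⟨x, Finset.mem_univ x⟩
  by_contra! hx
  have hw_pos : 0 < h w := hx.trans_le (hw x (Finset.mem_univ x))
  have key : ∀ v, Relation.ReflTransGen (fun a b => 0 < S.m a b) w v → h v = h w := by
    intro v hv
    induction hv with
    | refl => rfl
    | @tail b c _ hbc ih =>
      have hsum : ∑ v, (S.m b v : ℝ) * (h w - h v) = 0 := by
        have hb := harm b (ih ▸ hw_pos)
        simp only [Sandpile.deg, Nat.cast_sum, ih, Finset.sum_mul] at hb
        simp only [mul_sub, Finset.sum_sub_distrib, hb, sub_self]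
      have hc := (Finset.sum_eq_zero_iff_of_nonneg fun v hv =>
        mul_nonneg (Nat.cast_nonneg _) (sub_nonneg.2 (hw v hv))).1 hsum c (Finset.mem_univ c)
      have hm : (S.m b c : ℝ) ≠ 0 := Nat.cast_ne_zero.2 (Nat.pos_iff_ne_zero.1 hbc)
      linarith [(mul_eq_zero.1 hc).resolve_left hm]
  linarith [key S.sink (S.connected w S.sink)]

/-- **triangle inequality for potentials.** For ordinary vertices
`i, j, k` of a finite connected multigraph with sink `s`,
`π_i(j) · π_j(k) ≤ π_i(k)`. -/
theorem potential_triangle_inequality (S : Sandpile) (i j k : S.Ord)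
    (πi πj : S.V → ℝ) (hi : S.IsPotential i πi) (hj : S.IsPotential j πj) :
    πi j.1 * πj k.1 ≤ πi k.1 := by
  obtain ⟨hi_sink, hi_self, hi_mem, hi_harm⟩ := hi
  obtain ⟨hj_sink, hj_self, hj_mem, hj_harm⟩ := hj
  refine sub_nonpos.1 (S.nonpos_of_harmonic (fun u => πi j.1 * πj u - πi u) ?_ ?_ k.1)
  · simp [hi_sink, hj_sink]
  · intro u hu
    have hus : u ≠ S.sink := by
      rintro rfl
      simp [hi_sink, hj_sink] at hu
    have huj : u ≠ j.1 := by
      rintro rfl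
      simp [hj_self] at hu
    have hui : u ≠ i.1 := by
      rintro rfl
      have := mul_le_one₀ (hi_mem j.1).2 (hj_mem i.1).1 (hj_mem i.1).2
      simp only [hi_self] at hu
      linarith
    simp only [mul_sub, mul_left_comm _ (πi j.1), Finset.sum_sub_distrib, ← Finset.mul_sum,
      hi_harm u hus hui, hj_harm u hus huj]
end

section
/- (Potential reciprocity) Let G be a finite connected multigraph with sink s, and let t, v be ordinary vertices. Then R_eff(s,t) · π_t(v) = R_eff(s,v) · π_v(t). -/
/-- Regarding every edge as a unit resistor: `f` is the vector of node potentials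
when a unit current is injected at `t` and extracted at the (grounded) sink:
`f(s) = 0`, `f` is harmonic away from `s` and `t`, and the net current flowing out
of `t` equals `1`.  The effective resistance `R_eff(s, t)` is then `f t`. -/
def Sandpile.IsUnitCurrentPotential (S : Sandpile) (t : S.Ord) (f : S.V → ℝ) : Prop :=
  f S.sink = 0 ∧
    (∀ u : S.V, u ≠ S.sink → u ≠ t.1 →
      (S.deg u : ℝ) * f u = ∑ u', (S.m u u' : ℝ) * f u') ∧
    (∑ u, (S.m t.1 u : ℝ) * (f t.1 - f u)) = 1

namespace Sandpile

/-- The net current flowing out of `u` under the node potentials `f`. -/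
def outflow (S : Sandpile) (f : S.V → ℝ) (u : S.V) : ℝ :=
  ∑ u', (S.m u u' : ℝ) * (f u - f u')

lemma outflow_eq (S : Sandpile) (f : S.V → ℝ) (u : S.V) :
    S.outflow f u = S.deg u * f u - ∑ u', (S.m u u' : ℝ) * f u' := by
  simp only [outflow, deg, mul_sub, Finset.sum_sub_distrib, ← Finset.sum_mul, Nat.cast_sum]

lemma outflow_eq_zero_iff (S : Sandpile) (f : S.V → ℝ) (u : S.V) :
    S.outflow f u = 0 ↔ (S.deg u : ℝ) * f u = ∑ u', (S.m u u' : ℝ) * f u' := by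
  rw [outflow_eq, sub_eq_zero]

lemma outflow_sub_const_mul (S : Sandpile) (f g : S.V → ℝ) (a : ℝ) (u : S.V) :
    S.outflow (fun x => f x - a * g x) u = S.outflow f u - a * S.outflow g u := by
  simp only [outflow, Finset.mul_sum, ← Finset.sum_sub_distrib]
  exact Finset.sum_congr rfl fun _ _ => by ring

/-- Discrete Green identity: twice the pairing of `f` with the outflow of `g` is the
Dirichlet form. -/
lemma two_mul_sum_mul_outflow (S : Sandpile) (f g : S.V → ℝ) :
    2 * ∑ u, f u * S.outflow g u =
      ∑ u, ∑ u', (S.m u u' : ℝ) * ((f u - f u') * (g u - g u')) := by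
  have swap : ∑ u, f u * S.outflow g u =
      ∑ u, ∑ u', (S.m u u' : ℝ) * (f u' * (g u' - g u)) := by
    simp only [outflow, Finset.mul_sum]
    rw [Finset.sum_comm]
    refine Finset.sum_congr rfl fun u _ => Finset.sum_congr rfl fun u' _ => ?_
    rw [S.m_symm]
    ring
  rw [two_mul]
  nth_rewrite 2 [swap]
  simp only [outflow, Finset.mul_sum, ← Finset.sum_add_distrib]
  refine Finset.sum_congr rfl fun u _ => Finset.sum_congr rfl fun u' _ => ?_
  ring

lemma sum_mul_outflow_comm (S : Sandpile) (f g : S.V → ℝ) :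
    ∑ u, f u * S.outflow g u = ∑ u, g u * S.outflow f u := by
  have h : 2 * ∑ u, f u * S.outflow g u = 2 * ∑ u, g u * S.outflow f u := by
    rw [two_mul_sum_mul_outflow, two_mul_sum_mul_outflow]
    simp only [mul_comm (f _ - f _)]
  linarith

/-- A potential that vanishes wherever it is not harmonic, and vanishes at the sink,
is zero. -/
lemma eq_zero_of_mul_outflow_eq_zero (S : Sandpile) (g : S.V → ℝ) (hs : g S.sink = 0)
    (h : ∀ u, g u * S.outflow g u = 0) (u : S.V) : g u = 0 := by
  have energy : ∑ u, ∑ u', (S.m u u' : ℝ) * ((g u - g u') * (g u - g u')) = 0 := by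
    rw [← two_mul_sum_mul_outflow, Finset.sum_eq_zero fun u _ => h u, mul_zero]
  have nonneg : ∀ a b, 0 ≤ (S.m a b : ℝ) * ((g a - g b) * (g a - g b)) := fun a b =>
    mul_nonneg (Nat.cast_nonneg _) (mul_self_nonneg _)
  have edge : ∀ a b, 0 < S.m a b → g a = g b := by
    intro a b hab
    have ha := (Finset.sum_eq_zero_iff_of_nonneg
      fun a _ => Finset.sum_nonneg fun b _ => nonneg a b).1 energy a (Finset.mem_univ a)
    have hb := (Finset.sum_eq_zero_iff_of_nonneg fun b _ => nonneg a b).1 ha b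
      (Finset.mem_univ b)
    have hm : (S.m a b : ℝ) ≠ 0 := by exact_mod_cast hab.ne'
    exact sub_eq_zero.1 (mul_self_eq_zero.1 ((mul_eq_zero.1 hb).resolve_left hm))
  induction S.connected S.sink u with
  | refl => exact hs
  | tail _ hab ih => rw [← edge _ _ hab, ih]

/-- A unit current potential is the multiple of the unit potential by the effective
resistance. -/
lemma IsUnitCurrentPotential.eq_mul {S : Sandpile} {t : S.Ord} {f π : S.V → ℝ}
    (hf : S.IsUnitCurrentPotential t f) (hπ : S.IsPotential t π) (u : S.V) :
    f u = f t.1 * π u := by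
  refine sub_eq_zero.1 (S.eq_zero_of_mul_outflow_eq_zero (fun x => f x - f t.1 * π x)
    (by simp [hf.1, hπ.1]) (fun x => ?_) u)
  rcases eq_or_ne x S.sink with rfl | hxs
  · simp [hf.1, hπ.1]
  rcases eq_or_ne x t.1 with rfl | hxt
  · simp [hπ.2.1]
  · rw [outflow_sub_const_mul, (S.outflow_eq_zero_iff f x).2 (hf.2.1 x hxs hxt),
      (S.outflow_eq_zero_iff π x).2 (hπ.2.2.2 x hxs hxt)]
    simp

lemma IsUnitCurrentPotential.sum_mul_outflow {S : Sandpile} {t : S.Ord} {f : S.V → ℝ}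
    (hf : S.IsUnitCurrentPotential t f) (g : S.V → ℝ) (hg : g S.sink = 0) :
    ∑ u, g u * S.outflow f u = g t.1 := by
  rw [Finset.sum_eq_single t.1 _ (by simp), outflow, hf.2.2, mul_one]
  intro u _ hut
  rcases eq_or_ne u S.sink with rfl | hus
  · rw [hg, zero_mul]
  · rw [(S.outflow_eq_zero_iff f u).2 (hf.2.1 u hus hut), mul_zero]

end Sandpile

/-- **potential reciprocity.** For ordinary vertices `t, v`,
`R_eff(s,t) · π_t(v) = R_eff(s,v) · π_v(t)`. -/
theorem potential_reciprocity (S : Sandpile) (t v : S.Ord)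
    (πt πv ft fv : S.V → ℝ)
    (hπt : S.IsPotential t πt) (hπv : S.IsPotential v πv)
    (hft : S.IsUnitCurrentPotential t ft) (hfv : S.IsUnitCurrentPotential v fv) :
    ft t.1 * πt v.1 = fv v.1 * πv t.1 := by
  rw [← hft.eq_mul hπt, ← hfv.eq_mul hπv, ← hfv.sum_mul_outflow ft hft.1,
    ← hft.sum_mul_outflow fv hfv.1]
  exact S.sum_mul_outflow_comm ft fv
end

section
/- (LP upper bound) Let S be a sandpile with sink s, let v, w be ordinary vertices with π_w(v) > 0, and extend any z : V_o → ℝ by z(s) = 0. Suppose z : V_o → ℝ and x ∈ ℝ satisfy z(u) ≥ 0 for all u, x ≥ 0, z(w) ≤ 0, and for every ordinary vertex u: Σ_{u'} m(u,u')·z(u') − deg(u)·z(u) + [u = v]·x ≤ deg(u) − 1 (where [u = v] is 1 if u = v and 0 otherwise). Then x ≤ (1/π_w(v)) · Σ_{u ∈ V_o} (deg(u) − 1)·π_w(u). -/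
namespace Sandpile

/-- The graph Laplacian is self-adjoint. -/
theorem sum_laplacian_mul_comm (S : Sandpile) (f g : S.V → ℝ) :
    ∑ u, ((∑ u', (S.m u u' : ℝ) * f u') - (S.deg u : ℝ) * f u) * g u
      = ∑ u, ((∑ u', (S.m u u' : ℝ) * g u') - (S.deg u : ℝ) * g u) * f u := by
  simp only [sub_mul, Finset.sum_sub_distrib, Finset.sum_mul]
  congr 1
  · rw [Finset.sum_comm]
    refine Finset.sum_congr rfl fun a _ => Finset.sum_congr rfl fun b _ => ?_
    rw [S.m_symm b a]
    ring
  · exact Finset.sum_congr rfl fun u _ => by ring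

theorem sum_ord_eq_sum (S : Sandpile) (f : S.V → ℝ) (hf : f S.sink = 0) :
    ∑ u : S.Ord, f u.1 = ∑ u, f u := by
  rw [← Finset.sum_subtype (Finset.univ.filter fun u => u ≠ S.sink) (by simp) f,
    Finset.sum_filter]
  refine Finset.sum_congr rfl fun u _ => ?_
  split_ifs with h
  · rfl
  · rw [not_not.mp h, hf]

/-- A function vanishing at the sink and at `w` has Laplacian orthogonal to the potential
with poles at the sink and `w`. -/
theorem IsPotential.sum_laplacian_mul_eq_zero {S : Sandpile} {w : S.Ord} {π : S.V → ℝ}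
    (hπ : S.IsPotential w π) (z : S.V → ℝ) (hzsink : z S.sink = 0) (hzw : z w.1 = 0) :
    ∑ u : S.Ord, ((∑ u', (S.m u.1 u' : ℝ) * z u') - (S.deg u.1 : ℝ) * z u.1) * π u.1 = 0 := by
  obtain ⟨hsink, -, -, hharm⟩ := hπ
  rw [S.sum_ord_eq_sum
      (fun u => ((∑ u', (S.m u u' : ℝ) * z u') - (S.deg u : ℝ) * z u) * π u) (by simp [hsink]),
    S.sum_laplacian_mul_comm]
  refine Finset.sum_eq_zero fun u _ => ?_
  by_cases hs : u = S.sink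
  · simp [hs, hzsink]
  by_cases hw : u = w.1
  · simp [hw, hzw]
  · rw [hharm u hs hw, sub_self, zero_mul]

end Sandpile


/-- **LP upper bound.** Let `v, w` be ordinary vertices with
`π_w(v) > 0` and let `z : V → ℝ` (the extension of a toppling vector on `V_o`
by `z(s) = 0`) and `x ∈ ℝ` satisfy `z ≥ 0`, `x ≥ 0`, `z(w) ≤ 0` and, for every
ordinary vertex `u`,
`Σ_{u'} m(u,u')·z(u') − deg(u)·z(u) + [u = v]·x ≤ deg(u) − 1`.
Then `x ≤ (1/π_w(v)) · Σ_{u ∈ V_o} (deg(u) − 1)·π_w(u)`. -/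
theorem lp_upper_bound (S : Sandpile) (v w : S.Ord) (π : S.V → ℝ)
    (hπ : S.IsPotential w π) (hpos : 0 < π v.1)
    (z : S.V → ℝ) (x : ℝ)
    (hzsink : z S.sink = 0)
    (hznn : ∀ u, 0 ≤ z u) (hxnn : 0 ≤ x) (hzw : z w.1 ≤ 0)
    (hineq : ∀ u : S.Ord,
      (∑ u', (S.m u.1 u' : ℝ) * z u') - (S.deg u.1 : ℝ) * z u.1
        + (if u = v then x else 0) ≤ (S.deg u.1 : ℝ) - 1) :
    x ≤ (1 / π v.1) * ∑ u : S.Ord, ((S.deg u.1 : ℝ) - 1) * π u.1 := by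
  have hzero := hπ.sum_laplacian_mul_eq_zero z hzsink (le_antisymm hzw (hznn _))
  have hle := Finset.sum_le_sum fun (u : S.Ord) (_ : u ∈ Finset.univ) =>
    mul_le_mul_of_nonneg_right (hineq u) (hπ.2.2.1 u.1).1
  rw [Finset.sum_congr rfl fun u _ => add_mul _ _ _] at hle
  simp only [Finset.sum_add_distrib, hzero, zero_add, ite_mul, zero_mul,
    Finset.sum_ite_eq', Finset.mem_univ, if_true] at hle
  rw [one_div, inv_mul_eq_div, le_div_iff₀ hpos]
  exact hle
end

section
/- Let S be a sandpile whose ordinary vertices induce a connected multigraph and let w be an ordinary vertex. Then there exists an ordinary vertex v adjacent to the sink (m(v,s) ≥ 1) such that π_w(v) ≤ π_w(u) for every ordinary vertex u; that is, the minimum of π_w over ordinary vertices is attained at a vertex adjacent to the sink. -/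
/-- Every sandpile has an ordinary vertex adjacent to the sink, as soon as it has an ordinary
vertex. -/
theorem Sandpile.exists_ord_adj_sink (S : Sandpile) (w : S.Ord) :
    ∃ v : S.Ord, 1 ≤ S.m v.1 S.sink := by
  rcases (S.connected S.sink w.1).cases_head with h | ⟨c, hc, -⟩
  · exact absurd h.symm w.2
  · refine ⟨⟨c, ?_⟩, ?_⟩
    · rintro rfl
      simp [S.m_loopless] at hc
    · rwa [S.m_symm]

/-- If a potential is minimal over the ordinary vertices at `a`, and `a` is not adjacent to the
sink, then the potential takes the same value at every ordinary neighbour of `a`. -/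
theorem Sandpile.IsPotential.eq_of_isMin {S : Sandpile} {w : S.Ord} {π : S.V → ℝ}
    (hπ : S.IsPotential w π) {a b : S.Ord} (hmin : ∀ u : S.Ord, π a.1 ≤ π u.1)
    (ha : S.m a.1 S.sink = 0) (hab : 0 < S.m a.1 b.1) : π b.1 = π a.1 := by
  obtain ⟨-, hw, hbound, hharm⟩ := hπ
  by_cases haw : a = w
  · subst haw
    exact le_antisymm (hw ▸ (hbound b.1).2) (hmin b)
  · have hsum : ∑ u, (S.m a.1 u : ℝ) * (π u - π a.1) = 0 := by
      have h := hharm a.1 a.2 (fun h => haw (Subtype.ext h))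
      simp only [mul_sub, Finset.sum_sub_distrib, ← Finset.sum_mul, ← h]
      simp [Sandpile.deg]
    have hnonneg : ∀ u ∈ Finset.univ, 0 ≤ (S.m a.1 u : ℝ) * (π u - π a.1) := by
      intro u _
      by_cases hu : u = S.sink
      · simp [hu, ha]
      · exact mul_nonneg (Nat.cast_nonneg _) (sub_nonneg.2 (hmin ⟨u, hu⟩))
    have hb := (Finset.sum_eq_zero_iff_of_nonneg hnonneg).1 hsum b.1 (Finset.mem_univ _)
    have hm : (S.m a.1 b.1 : ℝ) ≠ 0 := by exact_mod_cast hab.ne'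
    exact sub_eq_zero.1 ((mul_eq_zero.1 hb).resolve_left hm)

/-- For a sandpile whose ordinary vertices induce a connected
multigraph and an ordinary vertex `w`, the minimum of the potential `π_w` over the
ordinary vertices is attained at a vertex adjacent to the sink. -/
theorem potential_min_at_boundary (S : Sandpile) (hconn : S.OrdinaryConnected)
    (w : S.Ord) (π : S.V → ℝ) (hπ : S.IsPotential w π) :
    ∃ v : S.Ord, 1 ≤ S.m v.1 S.sink ∧ ∀ u : S.Ord, π v.1 ≤ π u.1 := by
  have : Nonempty S.Ord := ⟨w⟩
  obtain ⟨a, ha⟩ := Finite.exists_min (fun u : S.Ord => π u.1)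
  obtain ⟨v, hv⟩ := S.exists_ord_adj_sink w
  by_contra! hcon
  have hmin : ∀ b : S.Ord, ∀ u : S.Ord, π b.1 ≤ π u.1 := by
    intro b
    induction hconn a b with
    | refl => exact ha
    | @tail c d _ hcd ih =>
      have hc : S.m c.1 S.sink = 0 := by
        by_contra hne
        obtain ⟨u, hu⟩ := hcon c (Nat.one_le_iff_ne_zero.2 hne)
        exact (ih u).not_gt hu
      intro u
      exact (hπ.eq_of_isMin ih hc hcd).trans_le (ih u)
  obtain ⟨u, hu⟩ := hcon v hv
  exact (hmin v u).not_gt hu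
end

section
/- Let c be a stable recurrent configuration of a sandpile S. Then for every edge of S joining two ordinary vertices u and v (i.e., m(u,v) ≥ 1 with u, v ≠ s), it is not the case that both c(u) = 0 and c(v) = 0; consequently the set {v ∈ V_o : c(v) = 0} is an independent set in the multigraph induced on the ordinary vertices. -/
namespace Sandpile

/-- A toppling cannot empty both endpoints of an edge: toppling one endpoint feeds the other, and
toppling any other vertex decreases neither. -/
theorem topple_pos_of_adjacent (S : Sandpile) {u v : S.Ord} (huv : 1 ≤ S.m u.1 v.1)
    {c : S.Config} (hc : 0 < c u + c v) (w : S.Ord) :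
    0 < S.topple c w u + S.topple c w v := by
  have hne : u ≠ v := by
    rintro rfl
    simp [S.m_loopless] at huv
  have hvu : 1 ≤ S.m v.1 u.1 := S.m_symm u.1 v.1 ▸ huv
  unfold topple
  by_cases hu : u = w
  · subst hu
    rw [if_neg hne.symm]
    omega
  · rw [if_neg hu]
    by_cases hv : v = w
    · subst hv
      omega
    · rw [if_neg hv]
      omega

theorem toppleSeq_pos_of_adjacent (S : Sandpile) {u v : S.Ord} (huv : 1 ≤ S.m u.1 v.1)
    (l : List S.Ord) (c : S.Config) (hc : 0 < c u + c v) :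
    0 < S.toppleSeq c l u + S.toppleSeq c l v := by
  induction l generalizing c with
  | nil => exact hc
  | cons w l ih => exact ih _ (S.topple_pos_of_adjacent huv hc w)

end Sandpile

/-- In a stable recurrent configuration, no edge joins two
ordinary vertices both of height `0`; equivalently, the set of zero-height ordinary
vertices is an independent set in the multigraph induced on the ordinary vertices. -/
theorem recurrent_zero_set_independent (S : Sandpile) (c : S.Config)
    (hstable : S.Stable c) (hrec : S.Recurrent c)
    (u v : S.Ord) (huv : 1 ≤ S.m u.1 v.1) :
    ¬ (c u = 0 ∧ c v = 0) := by
  rintro ⟨hu, hv⟩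
  obtain ⟨c₃, hle, l, -, rfl⟩ := hrec fun _ => 1
  have hpos := S.toppleSeq_pos_of_adjacent huv l c₃ (Nat.add_pos_left (hle u) _)
  omega
end

section
/- (Line circuit recurrence bound) Let k ≥ 2 be an integer, x ≥ 0 a real number, and V : {1,…,k} → ℝ a sequence satisfying V(k) = 1, V(k−1) = x + 1, and V(i) = (x+2)·V(i+1) − V(i+2) for all 1 ≤ i ≤ k−2. Then V(i) ≥ 0 for all i, and V(1) ≤ (x+1)·(x+2)^{k−2}. -/
/-- A sequence obeying the line circuit recurrence backwards from its last two values stays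
nonnegative, does not increase with the index, and grows at most geometrically. -/
theorem line_circuit_invariant {n : ℕ} {x : ℝ} (hx : 0 ≤ x) {V : ℕ → ℝ}
    (hlast : V (n + 2) = 1) (hprev : V (n + 1) = x + 1)
    (hrec : ∀ i : ℕ, 1 ≤ i → i ≤ n → V i = (x + 2) * V (i + 1) - V (i + 2))
    (m : ℕ) (hm : m ≤ n) :
    0 ≤ V (n - m + 2) ∧ V (n - m + 2) ≤ V (n - m + 1) ∧
      V (n - m + 1) ≤ (x + 1) * (x + 2) ^ m := by
  induction m with
  | zero => simp [hlast, hprev, hx]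
  | succ m ih =>
    obtain ⟨h0, hle, hub⟩ := ih (by omega)
    have hr := hrec (n - m) (by omega) (by omega)
    have hidx : n - (m + 1) + 1 = n - m := by omega
    have hidx' : n - (m + 1) + 2 = n - m + 1 := by omega
    rw [hidx, hidx', hr, pow_succ]
    have hpos : 0 ≤ V (n - m + 1) := h0.trans hle
    refine ⟨hpos, ?_, ?_⟩
    · nlinarith [mul_nonneg hx hpos]
    · nlinarith [mul_le_mul_of_nonneg_left hub (by linarith : 0 ≤ x + 2)]

/-- **line circuit recurrence bound.**  Let `k ≥ 2`, `x ≥ 0`, and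
let `V : {1,…,k} → ℝ` satisfy `V(k) = 1`, `V(k−1) = x + 1` and
`V(i) = (x+2)·V(i+1) − V(i+2)` for `1 ≤ i ≤ k−2`.  Then `V(i) ≥ 0` for all
`1 ≤ i ≤ k`, and `V(1) ≤ (x+1)·(x+2)^(k−2)`. -/
theorem line_circuit_bound (k : ℕ) (hk : 2 ≤ k) (x : ℝ) (hx : 0 ≤ x)
    (V : ℕ → ℝ) (hVk : V k = 1) (hVk1 : V (k - 1) = x + 1)
    (hrec : ∀ i : ℕ, 1 ≤ i → i ≤ k - 2 → V i = (x + 2) * V (i + 1) - V (i + 2)) :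
    (∀ i : ℕ, 1 ≤ i → i ≤ k → 0 ≤ V i) ∧ V 1 ≤ (x + 1) * (x + 2) ^ (k - 2) := by
  obtain ⟨n, rfl⟩ := Nat.exists_eq_add_of_le' hk
  have hinv := line_circuit_invariant hx hVk hVk1 hrec
  refine ⟨fun i hi hik => ?_, ?_⟩
  · obtain rfl | hlt := hik.eq_or_lt
    · simp [hVk]
    · obtain ⟨h0, hle, -⟩ := hinv (n + 1 - i) (by omega)
      have hidx : n - (n + 1 - i) + 1 = i := by omega
      rw [hidx] at hle
      exact h0.trans hle
  · simpa using (hinv n le_rfl).2.2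
end
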